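/- arXiv:2507.04217 — 4 statements merged into one kernel-verified Lean document; each statement's English description precedes it below -/
import Mathlib

section
/- Let X be a Banach space and f_1, f_2 : X → ℝ ∪ {+∞} convex functions. Let x̄ ∈ dom f_1 ∩ dom f_2 be such that 0 ∈ ∂f_1(x̄) + ∂f_2(x̄). Then the pair {f_1, f_2} is uniformly lower semicontinuous on X; that is, liminf_{‖x−u‖→0} (f_1(x) + f_2(u)) ≥ inf_{x∈X} (f_1(x) + f_2(x)). -/
open scoped Pointwise

noncomputable section

/-- Convexity of an extended-real-valued function, via convexity of the epigraph. -/
def ConvexE {X : Type*} [AddCommGroup X] [Module ℝ X] (g : X → EReal) : Prop :=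
  Convex ℝ {p : X × ℝ | g p.1 ≤ (p.2 : EReal)}

/-- The convex (Fenchel) subdifferential of an extended-real-valued function. -/
def subdiffE {X : Type*} [NormedAddCommGroup X] [NormedSpace ℝ X]
    (g : X → EReal) (x₀ : X) : Set (X →L[ℝ] ℝ) :=
  {p | ∀ x, g x₀ + (p (x - x₀) : EReal) ≤ g x}

/-- If `f₁, f₂` are convex functions with values in ℝ ∪ {+∞}, `xb ∈ dom f₁ ∩ dom f₂` and
`0 ∈ ∂f₁(xb) + ∂f₂(xb)`, then the pair `{f₁, f₂}` is uniformly lower semicontinuous on `X`: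
the lower limit of `f₁(x) + f₂(u)` as `‖x − u‖ → 0` is at least `inf (f₁ + f₂)`. -/
theorem pair_uniformly_lsc
    {X : Type*} [NormedAddCommGroup X] [NormedSpace ℝ X] [CompleteSpace X]
    (f₁ f₂ : X → EReal)
    (hbot₁ : ∀ x, f₁ x ≠ ⊥) (hbot₂ : ∀ x, f₂ x ≠ ⊥)
    (hconv₁ : ConvexE f₁) (hconv₂ : ConvexE f₂)
    (xb : X) (hdom₁ : f₁ xb ≠ ⊤) (hdom₂ : f₂ xb ≠ ⊤)
    (hsub : (0 : X →L[ℝ] ℝ) ∈ subdiffE f₁ xb + subdiffE f₂ xb) :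
    (⨅ x : X, f₁ x + f₂ x) ≤
      ⨆ (δ : ℝ) (_ : 0 < δ), ⨅ (p : X × X) (_ : ‖p.1 - p.2‖ ≤ δ), (f₁ p.1 + f₂ p.2) := by
  obtain ⟨p, hp, q, hq, hpq⟩ := hsub
  obtain rfl : q = -p := eq_neg_of_add_eq_zero_right hpq
  obtain ⟨a, ha⟩ : ∃ a : ℝ, (a : EReal) = f₁ xb :=
    ⟨_, EReal.coe_toReal hdom₁ (hbot₁ xb)⟩
  obtain ⟨b, hb⟩ : ∃ b : ℝ, (b : EReal) = f₂ xb :=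
    ⟨_, EReal.coe_toReal hdom₂ (hbot₂ xb)⟩
  have hinf : (⨅ x : X, f₁ x + f₂ x) ≤ ((a + b : ℝ) : EReal) := by
    refine (iInf_le _ xb).trans ?_
    rw [← ha, ← hb, EReal.coe_add]
  refine hinf.trans (EReal.ge_of_forall_gt_iff_ge.mp fun c hc => ?_)
  have hgap : 0 < a + b - c := sub_pos.mpr (EReal.coe_lt_coe_iff.mp hc)
  have hnorm : 0 < ‖p‖ + 1 := by positivity
  refine le_iSup₂_of_le ((a + b - c) / (‖p‖ + 1)) (div_pos hgap hnorm)
    (le_iInf₂ fun ⟨x, u⟩ hxu => ?_)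
  have hlower := add_le_add (hp x) (hq u)
  rw [← ha, ← hb] at hlower
  refine le_trans ?_ hlower
  norm_cast
  have hbound : |p (x - u)| ≤ ‖p‖ * ‖x - u‖ := p.le_opNorm (x - u)
  have hdist : ‖x - u‖ * (‖p‖ + 1) ≤ a + b - c := (le_div_iff₀ hnorm).mp hxu
  have habs := neg_abs_le (p (x - u))
  simp only [neg_apply, map_sub] at *
  nlinarith [norm_nonneg (x - u)]

end
end

section
/- Let X be a Banach space, T a nonempty index set, U ⊆ X, and f_t : X → ℝ ∪ {+∞} (t ∈ T). Then Θ_U({f_t}_{t∈T}) ≥ inf_{x∈U} (∑̄_{t∈T} f_t)(x) − Λ_U({f_t}_{t∈T}); in particular, every collection that is firmly uniformly lower semicontinuous on U is uniformly lower semicontinuous on U. -/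
open scoped BigOperators

noncomputable section

/-- The infinite (upper) sum of a family of extended-real-valued functions. -/
def upperSum {X : Type*} {T : Type*} (f : T → X → EReal) (x : X) : EReal :=
  ⨅ S₀ : Finset T, ⨆ S : Finset T, ⨆ _ : S₀ ⊆ S, ∑ t ∈ S, f t x

/-- The uniform infimum Λ_U of a family of functions on a set U. -/
def unifInf {X : Type*} [NormedAddCommGroup X] {T : Type*}
    (f : T → X → EReal) (U : Set X) : EReal :=
  ⨆ S₀ : Finset T, ⨅ S : Finset T, ⨅ _ : S₀ ⊆ S,
    ⨆ (δ : ℝ) (_ : 0 < δ),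
      ⨅ (x : T → X) (_ : (∀ t ∈ S, x t ∈ U) ∧ ∀ s ∈ S, ∀ t ∈ S, dist (x s) (x t) ≤ δ),
        ∑ t ∈ S, f t (x t)

/-- The quantity Θ_U measuring firm uniform lower semicontinuity of a family
of functions on a set U. -/
def thetaU {X : Type*} [NormedAddCommGroup X] {T : Type*}
    (f : T → X → EReal) (U : Set X) : EReal :=
  ⨅ S₀ : Finset T, ⨆ S : Finset T, ⨆ _ : S₀ ⊆ S,
    ⨅ (δ : ℝ) (_ : 0 < δ),
      ⨆ (x : T → X) (_ : (∀ t ∈ S, f t (x t) ≠ ⊤) ∧ ∀ s ∈ S, ∀ t ∈ S, dist (x s) (x t) ≤ δ),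
        ⨅ y ∈ U, max (⨆ t ∈ S, ((dist y (x t) : ℝ) : EReal))
          (upperSum f y - ∑ t ∈ S, f t (x t))

theorem EReal.sum_ne_bot {ι : Type*} {s : Finset ι} {g : ι → EReal}
    (h : ∀ i ∈ s, g i ≠ ⊥) : ∑ i ∈ s, g i ≠ ⊥ := by
  classical
  induction s using Finset.induction_on with
  | empty => simp
  | insert i s hi ih =>
    rw [Finset.sum_insert hi, Ne, EReal.add_eq_bot_iff, not_or]
    exact ⟨h i (s.mem_insert_self i), ih fun j hj => h j (Finset.mem_insert_of_mem hj)⟩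

theorem EReal.ne_top_of_sum_ne_top {ι : Type*} {s : Finset ι} {g : ι → EReal}
    (h : ∀ i ∈ s, g i ≠ ⊥) (hs : ∑ i ∈ s, g i ≠ ⊤) {i : ι} (hi : i ∈ s) : g i ≠ ⊤ := by
  classical
  intro htop
  rw [← Finset.add_sum_erase s g hi, htop] at hs
  exact hs <| EReal.top_add_of_ne_bot <|
    EReal.sum_ne_bot fun j hj => h j (Finset.mem_of_mem_erase hj)

theorem iInf_upperSum_le_add {X T : Type*} [NormedAddCommGroup X] {f : T → X → EReal}
    (hbot : ∀ t x, f t x ≠ ⊥) {U : Set X} {c l : EReal}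
    (hc : thetaU f U < c) (hl : unifInf f U < l) : (⨅ x ∈ U, upperSum f x) ≤ c + l := by
  obtain ⟨S₀, hS₀⟩ := iInf_lt_iff.1 hc
  obtain ⟨S, hS⟩ := iInf_lt_iff.1 ((le_iSup _ S₀).trans_lt hl)
  obtain ⟨hsub, hS⟩ := iInf_lt_iff.1 hS
  obtain ⟨δ, hδ⟩ := iInf_lt_iff.1 ((le_iSup₂ S hsub).trans_lt hS₀)
  obtain ⟨hδ0, hδ⟩ := iInf_lt_iff.1 hδ
  obtain ⟨x, hx⟩ := iInf_lt_iff.1 ((le_iSup₂ δ hδ0).trans_lt hS)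
  obtain ⟨⟨-, hxδ⟩, hx⟩ := iInf_lt_iff.1 hx
  have hdom : ∀ t ∈ S, f t (x t) ≠ ⊤ := fun t ht =>
    EReal.ne_top_of_sum_ne_top (fun t _ => hbot t (x t)) hx.ne_top ht
  obtain ⟨y, hy⟩ := iInf_lt_iff.1 ((le_iSup₂ x ⟨hdom, hxδ⟩).trans_lt hδ)
  obtain ⟨hyU, hy⟩ := iInf_lt_iff.1 hy
  have hsum : ∑ t ∈ S, f t (x t) ≠ ⊥ := EReal.sum_ne_bot fun t _ => hbot t (x t)
  have hlt := (le_max_right _ _).trans_lt hy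
  rw [EReal.sub_lt_iff (Or.inl hsum) (Or.inl hx.ne_top)] at hlt
  exact (iInf₂_le y hyU).trans (hlt.le.trans (by gcongr))

/-- Θ_U dominates the difference between the infimum of the upper sum over U and the
uniform infimum Λ_U; in particular, firm uniform lower semicontinuity implies
uniform lower semicontinuity. -/
theorem thetaU_ge_and_firm_implies_uniform
    {X : Type*} [NormedAddCommGroup X] [NormedSpace ℝ X] [CompleteSpace X]
    {T : Type*} [Nonempty T] (f : T → X → EReal)
    (hbot : ∀ t x, f t x ≠ ⊥)
    (U : Set X) :
    (⨅ x ∈ U, upperSum f x) - unifInf f U ≤ thetaU f U ∧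
      (thetaU f U = 0 → (⨅ x ∈ U, upperSum f x) ≤ unifInf f U) := by
  refine ⟨?_, fun h0 => ?_⟩
  · by_cases hΛ : unifInf f U = ⊤
    · simp [hΛ]
    by_cases hΘ : thetaU f U = ⊤
    · simp [hΘ]
    exact EReal.sub_le_of_le_add <| EReal.le_add_of_forall_gt (Or.inr hΛ) (Or.inl hΘ)
      fun c hc l hl => iInf_upperSum_le_add hbot hc hl
  · rw [← zero_add (unifInf f U)]
    exact EReal.le_add_of_forall_gt (Or.inl EReal.zero_ne_bot) (Or.inl EReal.zero_ne_top)
      fun c hc l hl => iInf_upperSum_le_add hbot (h0.trans_lt hc) hl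

end
end

section
/- Consider problem (P), let x̄ ∈ X be a solution of (P), and suppose the Slater condition holds. Then for every m ∈ ℕ ∪ {0}: (a) there exists a solution (λ_1, λ_2, …) ∈ ℓ^∞ with λ_k ≥ 0 of the dual (D_m), i.e. f_0(x̄) = inf_{x∈X} ( f_0(x) + ∑_{k=1}^m λ_k f_k(x) + ∑̄_{k>m} λ_k f_k⁺(x) ); (b) for every solution of (D_m), this infimum is attained at x̄ and the partial complementary slackness conditions hold: λ_k f_k(x̄) = 0 for k = 1, …, m. -/
open scoped BigOperators Pointwise

noncomputable section

/-- A proper extended-real-valued function: never −∞ and not identically +∞. -/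
def ProperE {X : Type*} (g : X → EReal) : Prop := (∀ x, g x ≠ ⊥) ∧ ∃ x, g x ≠ ⊤

/-- Scalar multiplication of an extended real by a real number, with the
convention 0 · (+∞) = +∞. -/
def smulE (c : ℝ) (a : EReal) : EReal := if a = ⊤ then ⊤ else (c : EReal) * a

-- In the data `f : ℕ → X → EReal`, `f 0` is the objective and `f k` (k ≥ 1)
-- are the constraint functions of problem (P): minimize f 0 x subject to f k x ≤ 0 (k ≥ 1).

/-- The limit function f_∞ := limsup_{k→∞} f_k. -/
def fLim {X : Type*} (f : ℕ → X → EReal) (x : X) : EReal :=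
  Filter.limsup (fun k => f k x) Filter.atTop

/-- The Lagrangian L(x, λ, λ_∞) = f_0(x) + ∑̄_{k∈ℕ} λ_k f_k(x) + λ_∞ f_∞(x)
of the dual problem (D), where ∑̄ is the upper limit of partial sums. -/
def lagD {X : Type*} (f : ℕ → X → EReal) (lam : ℕ → ℝ) (lamInf : ℝ) (x : X) : EReal :=
  f 0 x + Filter.limsup (fun n => ∑ k ∈ Finset.Icc 1 n, smulE (lam k) (f k x)) Filter.atTop
    + smulE lamInf (fLim f x)

/-- The Lagrangian L_m(x, λ) = f_0(x) + ∑_{k=1}^m λ_k f_k(x) + ∑̄_{k>m} λ_k f_k⁺(x)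
of the dual problem (D_m). -/
def lagDm {X : Type*} (f : ℕ → X → EReal) (m : ℕ) (lam : ℕ → ℝ) (x : X) : EReal :=
  f 0 x + ∑ k ∈ Finset.Icc 1 m, smulE (lam k) (f k x)
    + Filter.limsup (fun n => ∑ k ∈ Finset.Icc (m + 1) n, smulE (lam k) (max (f k x) 0))
        Filter.atTop

/-- Membership in ℓ¹ with nonnegative entries. -/
def memL1 (lam : ℕ → ℝ) : Prop := Summable lam ∧ ∀ k, 0 ≤ lam k

/-- Membership in ℓ^∞ with nonnegative entries. -/
def memLinfty (lam : ℕ → ℝ) : Prop := (∃ M : ℝ, ∀ k, |lam k| ≤ M) ∧ ∀ k, 0 ≤ lam k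

/-- The optimal value v(P) of problem (P). -/
def vP {X : Type*} (f : ℕ → X → EReal) : EReal :=
  ⨅ (x : X) (_ : ∀ k, 1 ≤ k → f k x ≤ 0), f 0 x

/-- The optimal value v(P_ε) of the perturbed problem (P_ε). -/
def vPeps {X : Type*} (f : ℕ → X → EReal) (ε : ℝ) : EReal :=
  ⨅ (x : X) (_ : ∀ k, 1 ≤ k → f k x ≤ (ε : EReal)), f 0 x

/-- The optimal value v(D) of the dual problem (D). -/
def vD {X : Type*} (f : ℕ → X → EReal) : EReal :=
  ⨆ (lam : ℕ → ℝ) (lamInf : ℝ) (_ : memL1 lam ∧ 0 ≤ lamInf), ⨅ x : X, lagD f lam lamInf x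

/-- The optimal value v(D_m) of the dual problem (D_m). -/
def vDm {X : Type*} (f : ℕ → X → EReal) (m : ℕ) : EReal :=
  ⨆ (lam : ℕ → ℝ) (_ : memLinfty lam), ⨅ x : X, lagDm f m lam x

/-- The Slater condition for problem (P). -/
def SlaterE {X : Type*} (f : ℕ → X → EReal) : Prop :=
  ∃ x : X, f 0 x ≠ ⊤ ∧ (⨆ (k : ℕ) (_ : 1 ≤ k), f k x) < 0

/-- Feasibility of x for (P) together with nonemptiness data C ≠ ∅. -/
def feasE {X : Type*} (f : ℕ → X → EReal) (x : X) : Prop := ∀ k, 1 ≤ k → f k x ≤ 0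

section ConvexDuality

variable {E : Type*} [AddCommGroup E] [Module ℝ E]

/-- Lagrange multiplier rule for a single convex inequality under the Slater condition. -/
lemma exists_multiplier_of_convexOn {S : Set E} {G g : E → ℝ} (hG : ConvexOn ℝ S G)
    (hg : ConvexOn ℝ S g) {x₀ : E} (hx₀ : x₀ ∈ S) (hgx₀ : g x₀ < 0) {v : ℝ}
    (hv : ∀ x ∈ S, g x ≤ 0 → v ≤ G x) :
    ∃ c : ℝ, 0 ≤ c ∧ ∀ x ∈ S, v ≤ G x + c * g x := by
  have key : ∀ x ∈ S, 0 < g x → ∀ y ∈ S, g y < 0 →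
      (v - G x) / g x ≤ (G y - v) / (-g y) := by
    intro x hx hgx y hy hgy
    have hd : 0 < g x - g y := by linarith
    have ha : 0 ≤ -g y / (g x - g y) := div_nonneg (by linarith) hd.le
    have hb : 0 ≤ g x / (g x - g y) := div_nonneg hgx.le hd.le
    have hab : -g y / (g x - g y) + g x / (g x - g y) = 1 := by
      field_simp
      ring
    have hg0 := hg.2 hx hy ha hb hab
    have hGv := hG.2 hx hy ha hb hab
    simp only [smul_eq_mul] at hg0 hGv
    have hzero : -g y / (g x - g y) * g x + g x / (g x - g y) * g y = 0 := by
      field_simp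
      ring
    have hle := (hv _ (hG.1 hx hy ha hb hab) (hzero ▸ hg0)).trans hGv
    have hsum : -g y / (g x - g y) * G x + g x / (g x - g y) * G y
        = (-g y * G x + g x * G y) / (g x - g y) := by
      field_simp
    rw [hsum, le_div_iff₀ hd] at hle
    rw [div_le_div_iff₀ hgx (by linarith)]
    linarith
  set A : Set ℝ := insert 0 {r | ∃ x ∈ S, 0 < g x ∧ r = (v - G x) / g x} with hA
  have hub : ∀ y ∈ S, g y < 0 → ∀ r ∈ A, r ≤ (G y - v) / (-g y) := by
    rintro y hy hgy r (rfl | ⟨x, hx, hgx, rfl⟩)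
    · exact div_nonneg (by linarith [hv y hy hgy.le]) (by linarith)
    · exact key x hx hgx y hy hgy
  have hbdd : BddAbove A := ⟨_, hub x₀ hx₀ hgx₀⟩
  have h0 : (0 : ℝ) ∈ A := Set.mem_insert _ _
  refine ⟨sSup A, le_csSup hbdd h0, fun x hx => ?_⟩
  rcases lt_trichotomy (g x) 0 with hgx | hgx | hgx
  · have h := csSup_le ⟨0, h0⟩ (hub x hx hgx)
    rw [le_div_iff₀ (by linarith)] at h
    linarith
  · rw [hgx, mul_zero, add_zero]
    exact hv x hx hgx.le
  · have h : (v - G x) / g x ≤ sSup A :=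
      le_csSup hbdd (Set.mem_insert_of_mem _ ⟨x, hx, hgx, rfl⟩)
    rw [div_le_iff₀ hgx] at h
    linarith

/-- Lagrange multiplier rule for finitely many convex inequalities under the Slater condition. -/
lemma exists_multipliers_of_convexOn {ι : Type*} [DecidableEq ι] {S : Set E} {g : ι → E → ℝ}
    (hg : ∀ i, ConvexOn ℝ S (g i)) {x₀ : E} (hx₀ : x₀ ∈ S) {v : ℝ} (s : Finset ι)
    (hgx₀ : ∀ i ∈ s, g i x₀ < 0) {G : E → ℝ} (hG : ConvexOn ℝ S G)
    (hv : ∀ x ∈ S, (∀ i ∈ s, g i x ≤ 0) → v ≤ G x) :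
    ∃ c : ι → ℝ, (∀ i, 0 ≤ c i) ∧ ∀ x ∈ S, v ≤ G x + ∑ i ∈ s, c i * g i x := by
  induction s using Finset.induction_on generalizing G with
  | empty => exact ⟨0, fun _ => le_rfl, fun x hx => by simpa using hv x hx (by simp)⟩
  | insert a s ha ih =>
    have hS' : Convex ℝ {x | x ∈ S ∧ ∀ i ∈ s, g i x ≤ 0} := by
      rintro x ⟨hx, hxs⟩ y ⟨hy, hys⟩ p q hp hq hpq
      refine ⟨hG.1 hx hy hp hq hpq, fun i hi => ((hg i).2 hx hy hp hq hpq).trans ?_⟩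
      simp only [smul_eq_mul]
      nlinarith [hxs i hi, hys i hi]
    have hsub : {x | x ∈ S ∧ ∀ i ∈ s, g i x ≤ 0} ⊆ S := fun x hx => hx.1
    obtain ⟨d, hd, hdv⟩ := exists_multiplier_of_convexOn (hG.subset hsub hS')
      ((hg a).subset hsub hS')
      (x₀ := x₀) ⟨hx₀, fun i hi => (hgx₀ i (Finset.mem_insert_of_mem hi)).le⟩
      (hgx₀ a (Finset.mem_insert_self _ _)) (v := v)
      (fun x hx hax => hv x hx.1 (Finset.forall_mem_insert _ _ _ |>.2 ⟨hax, hx.2⟩))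
    obtain ⟨c, hc, hcv⟩ := ih (fun i hi => hgx₀ i (Finset.mem_insert_of_mem hi))
      (G := fun x => G x + d * g a x) (hG.add ((hg a).smul hd)) (fun x hx hxs => hdv x ⟨hx, hxs⟩)
    refine ⟨Function.update c a d, fun i => ?_, fun x hx => ?_⟩
    · by_cases hi : i = a
      · subst hi
        simpa using hd
      · simpa [hi] using hc i
    · have hsum : ∑ i ∈ s, Function.update c a d i * g i x = ∑ i ∈ s, c i * g i x :=
        Finset.sum_congr rfl fun i hi => by
          rw [Function.update_of_ne (ne_of_mem_of_not_mem hi ha)]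
      rw [Finset.sum_insert ha, Function.update_self, hsum]
      linarith [hcv x hx]

/-- Exact penalization: a common bound `t` on the constraint functions is penalized exactly by
a multiple of `t`, under the Slater condition. -/
lemma ConvexE.le_add_penalty {f : ℕ → E → EReal} (hconv : ∀ k, ConvexE (f k)) {v : ℝ}
    (hv : ∀ x, feasE f x → (v : EReal) ≤ f 0 x) {x₀ : E} {r s : ℝ} (hs : 0 < s)
    (hr : f 0 x₀ ≤ r) (hx₀ : ∀ k, 1 ≤ k → f k x₀ ≤ ((-s : ℝ) : EReal))
    {x : E} {y t : ℝ} (ht : 0 ≤ t) (hy : f 0 x ≤ y) (hx : ∀ k, 1 ≤ k → f k x ≤ t) :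
    v ≤ y + (r - v) / s * t := by
  have hst : 0 < s + t := by linarith
  have ha : 0 ≤ s / (s + t) := by positivity
  have hb : 0 ≤ t / (s + t) := by positivity
  have hab : s / (s + t) + t / (s + t) = 1 := by field_simp
  have hfeas : feasE f ((s / (s + t)) • x + (t / (s + t)) • x₀) := by
    intro k hk
    have h := @hconv k (x, t) (hx k hk) (x₀, -s) (hx₀ k hk) _ _ ha hb hab
    simp only [Set.mem_ofPred_eq, Prod.smul_mk, Prod.mk_add_mk, smul_eq_mul] at h
    have h0 : s / (s + t) * t + t / (s + t) * (-s) = 0 := by ring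
    rwa [h0] at h
  have h := @hconv 0 (x, y) hy (x₀, r) hr _ _ ha hb hab
  simp only [Set.mem_ofPred_eq, Prod.smul_mk, Prod.mk_add_mk, smul_eq_mul] at h
  have hle : v ≤ s / (s + t) * y + t / (s + t) * r := by
    exact_mod_cast (hv _ hfeas).trans h
  have e : s / (s + t) * y + t / (s + t) * r = (s * y + t * r) / (s + t) := by ring
  rw [e, le_div_iff₀ hst] at hle
  have e' : y + (r - v) / s * t = (s * y + (r - v) * t) / s := by field_simp
  rw [e', le_div_iff₀ hs]
  linarith

end ConvexDuality

lemma smulE_coe (c a : ℝ) : smulE c (a : EReal) = ((c * a : ℝ) : EReal) := by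
  simp [smulE]

lemma smulE_zero (c : ℝ) : smulE c 0 = 0 := by
  simp [smulE]

lemma smulE_ne_bot (c : ℝ) {a : EReal} (ha : a ≠ ⊥) : smulE c a ≠ ⊥ := by
  induction a with
  | bot => exact absurd rfl ha
  | coe a =>
    rw [smulE_coe]
    exact EReal.coe_ne_bot _
  | top => simp [smulE]

lemma smulE_nonpos {c : ℝ} (hc : 0 ≤ c) {a : EReal} (ha : a ≤ 0) (ha' : a ≠ ⊥) :
    smulE c a ≤ 0 := by
  induction a with
  | bot => exact absurd rfl ha'
  | coe a =>
    rw [smulE_coe]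
    exact_mod_cast mul_nonpos_of_nonneg_of_nonpos hc (by exact_mod_cast ha)
  | top => simp at ha

lemma smulE_nonneg {c : ℝ} (hc : 0 ≤ c) {a : EReal} (ha : 0 ≤ a) : 0 ≤ smulE c a := by
  unfold smulE
  split_ifs
  · exact le_top
  · exact mul_nonneg (by exact_mod_cast hc) ha

lemma ereal_coe_sum {ι : Type*} (s : Finset ι) (a : ι → ℝ) :
    ((∑ i ∈ s, a i : ℝ) : EReal) = ∑ i ∈ s, (a i : EReal) := by
  classical
  induction s using Finset.induction_on with
  | empty => simp
  | insert i s hi ih => rw [Finset.sum_insert hi, Finset.sum_insert hi, EReal.coe_add, ih]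

lemma ereal_sum_ne_bot {ι : Type*} {s : Finset ι} {a : ι → EReal} (h : ∀ i ∈ s, a i ≠ ⊥) :
    ∑ i ∈ s, a i ≠ ⊥ :=
  Finset.sum_induction a (· ≠ ⊥) (fun _ _ hx hy => EReal.add_ne_bot_iff.2 ⟨hx, hy⟩) (by simp) h

lemma ereal_sum_eq_top {ι : Type*} {s : Finset ι} {a : ι → EReal}
    (h : ∀ i ∈ s, a i ≠ ⊥) {j : ι} (hj : j ∈ s) (htop : a j = ⊤) : ∑ i ∈ s, a i = ⊤ := by
  classical
  rw [← Finset.add_sum_erase s a hj, htop]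
  exact EReal.top_add_of_ne_bot (ereal_sum_ne_bot fun i hi => h i (Finset.mem_of_mem_erase hi))

section Lagrangian

variable {X : Type*} {f : ℕ → X → EReal} {m : ℕ} {lam : ℕ → ℝ} {x : X}

lemma term_le_tail (hlam : ∀ k, 0 ≤ lam k) {k : ℕ} (hk : m < k) :
    smulE (lam k) (max (f k x) 0) ≤
      Filter.limsup (fun n => ∑ k ∈ Finset.Icc (m + 1) n, smulE (lam k) (max (f k x) 0))
        Filter.atTop := by
  refine Filter.le_limsup_of_frequently_le (Filter.Eventually.frequently ?_)
  filter_upwards [Filter.eventually_ge_atTop k] with n hn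
  exact Finset.single_le_sum (f := fun k => smulE (lam k) (max (f k x) 0))
    (fun i _ => smulE_nonneg (hlam i) (le_max_right _ _)) (Finset.mem_Icc.2 ⟨hk, hn⟩)

lemma zero_le_tail (hlam : ∀ k, 0 ≤ lam k) :
    0 ≤ Filter.limsup (fun n => ∑ k ∈ Finset.Icc (m + 1) n, smulE (lam k) (max (f k x) 0))
        Filter.atTop :=
  (smulE_nonneg (hlam _) (le_max_right _ _)).trans (term_le_tail hlam (Nat.lt_succ_self m))

/-- At a feasible point the tail of the Lagrangian vanishes. -/
lemma lagDm_of_feasE (hx : feasE f x) :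
    lagDm f m lam x = f 0 x + ∑ k ∈ Finset.Icc 1 m, smulE (lam k) (f k x) := by
  have h : ∀ n, ∑ k ∈ Finset.Icc (m + 1) n, smulE (lam k) (max (f k x) 0) = 0 := fun n =>
    Finset.sum_eq_zero fun k hk => by
      rw [max_eq_right (hx k (by linarith [(Finset.mem_Icc.1 hk).1])), smulE_zero]
  simp [lagDm, h]

lemma lagDm_le_of_feasE (hbot : ∀ k, f k x ≠ ⊥) (hlam : ∀ k, 0 ≤ lam k) (hx : feasE f x) :
    lagDm f m lam x ≤ f 0 x := by
  rw [lagDm_of_feasE hx]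
  have h : ∑ k ∈ Finset.Icc 1 m, smulE (lam k) (f k x) ≤ 0 :=
    Finset.sum_nonpos fun k hk =>
      smulE_nonpos (hlam k) (hx k (Finset.mem_Icc.1 hk).1) (hbot k)
  simpa using add_le_add_right h (f 0 x)

/-- Equality in weak duality forces complementary slackness. -/
lemma smulE_eq_zero_of_le_lagDm (hbot : ∀ k, f k x ≠ ⊥) (htop : f 0 x ≠ ⊤)
    (hlam : ∀ k, 0 ≤ lam k) (hx : feasE f x) (hle : f 0 x ≤ lagDm f m lam x)
    {k : ℕ} (hk : 1 ≤ k) (hkm : k ≤ m) : smulE (lam k) (f k x) = 0 := by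
  have hcoe : ∀ j, 1 ≤ j → f j x = ((f j x).toReal : EReal) := fun j hj =>
    (EReal.coe_toReal (fun h => by simpa [h] using hx j hj) (hbot j)).symm
  have hnonpos : ∀ j ∈ Finset.Icc 1 m, lam j * (f j x).toReal ≤ 0 := fun j hj => by
    have h := hx j (Finset.mem_Icc.1 hj).1
    rw [hcoe j (Finset.mem_Icc.1 hj).1] at h
    exact mul_nonpos_of_nonneg_of_nonpos (hlam j) (by exact_mod_cast h)
  have hsum : ∑ j ∈ Finset.Icc 1 m, smulE (lam j) (f j x)
      = ((∑ j ∈ Finset.Icc 1 m, lam j * (f j x).toReal : ℝ) : EReal) := by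
    rw [ereal_coe_sum]
    refine Finset.sum_congr rfl fun j hj => ?_
    rw [hcoe j (Finset.mem_Icc.1 hj).1, smulE_coe, EReal.toReal_coe]
  rw [lagDm_of_feasE hx, hsum, ← EReal.coe_toReal htop (hbot 0)] at hle
  have hle' : (f 0 x).toReal ≤ (f 0 x).toReal + ∑ j ∈ Finset.Icc 1 m, lam j * (f j x).toReal := by
    exact_mod_cast hle
  have hzero := (Finset.sum_eq_zero_iff_of_nonpos hnonpos).1
    (le_antisymm (Finset.sum_nonpos hnonpos) (by linarith)) k (Finset.mem_Icc.2 ⟨hk, hkm⟩)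
  rw [hcoe k hk, smulE_coe, hzero, EReal.coe_zero]

/-- A lower bound for the epigraphical Lagrangian, with uniform weight `c` on the tail, bounds
the Lagrangian of `(D_m)`. -/
lemma le_lagDm (hbot : ∀ k, f k x ≠ ⊥) (hlam : ∀ k, 0 ≤ lam k) {c v : ℝ} (hc : 0 < c)
    (htail : ∀ k, m < k → lam k = c)
    (h : ∀ (y : ℕ → ℝ) (t : ℝ), 0 ≤ t → (∀ k ≤ m, f k x ≤ y k) → (∀ k, m < k → f k x ≤ t) →
      v ≤ y 0 + c * t + ∑ k ∈ Finset.Icc 1 m, lam k * y k) :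
    (v : EReal) ≤ lagDm f m lam x := by
  have hne : ∀ k ∈ Finset.Icc 1 m, smulE (lam k) (f k x) ≠ ⊥ := fun k _ =>
    smulE_ne_bot (lam k) (hbot k)
  have hT0 := zero_le_tail (f := f) (m := m) (x := x) hlam
  have hTk := fun k (hk : m < k) => term_le_tail (f := f) (x := x) hlam hk
  unfold lagDm
  generalize Filter.limsup (fun n => ∑ k ∈ Finset.Icc (m + 1) n, smulE (lam k) (max (f k x) 0))
    Filter.atTop = T at hT0 hTk ⊢
  have hTbot : T ≠ ⊥ := fun h => by simp [h] at hT0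
  by_cases hfin : ∀ k ≤ m, f k x ≠ ⊤
  · induction T with
    | bot => exact absurd rfl hTbot
    | top =>
      rw [EReal.add_top_of_ne_bot (EReal.add_ne_bot_iff.2 ⟨hbot 0, ereal_sum_ne_bot hne⟩)]
      exact le_top
    | coe τ =>
      have hτ : 0 ≤ τ := by exact_mod_cast hT0
      have hcoe : ∀ k ≤ m, f k x = ((f k x).toReal : EReal) := fun k hk =>
        (EReal.coe_toReal (hfin k hk) (hbot k)).symm
      have hv := h (fun k => (f k x).toReal) (τ / c) (by positivity) (fun k hk => (hcoe k hk).le)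
        (fun k hk => by
          have hk' := hTk k hk
          rw [htail k hk] at hk'
          have hb := hbot k
          generalize f k x = a at hk' hb ⊢
          induction a with
          | bot => exact absurd rfl hb
          | top => simp [smulE] at hk'
          | coe a =>
            have e : max (a : EReal) 0 = ((max a 0 : ℝ) : EReal) := by
              rw [EReal.coe_strictMono.monotone.map_max, EReal.coe_zero]
            rw [e, smulE_coe, EReal.coe_le_coe_iff] at hk'
            rw [EReal.coe_le_coe_iff, le_div_iff₀ hc]
            nlinarith [le_max_left a 0])
      have hsum : ∑ j ∈ Finset.Icc 1 m, smulE (lam j) (f j x)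
          = ((∑ j ∈ Finset.Icc 1 m, lam j * (f j x).toReal : ℝ) : EReal) := by
        rw [ereal_coe_sum]
        refine Finset.sum_congr rfl fun j hj => ?_
        rw [hcoe j (Finset.mem_Icc.1 hj).2, smulE_coe, EReal.toReal_coe]
      rw [hsum, hcoe 0 (Nat.zero_le m)]
      rw [mul_div_cancel₀ _ hc.ne'] at hv
      norm_cast
      linarith
  · push Not at hfin
    obtain ⟨k, hkm, hk⟩ := hfin
    have htop : f 0 x + ∑ k ∈ Finset.Icc 1 m, smulE (lam k) (f k x) = ⊤ := by
      rcases Nat.eq_zero_or_pos k with rfl | hpos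
      · rw [hk, EReal.top_add_of_ne_bot (ereal_sum_ne_bot hne)]
      · rw [ereal_sum_eq_top hne (Finset.mem_Icc.2 ⟨hpos, hkm⟩) (by simp [smulE, hk]),
          EReal.add_top_of_ne_bot (hbot 0)]
    rw [htop, EReal.top_add_of_ne_bot hTbot]
    exact le_top

end Lagrangian

/-- The joint epigraph of `f 0, …, f m` and of the tail functions `f k`, `k > m`, the latter
sharing one nonnegative bound. -/
def jointEpi {X : Type*} (f : ℕ → X → EReal) (m : ℕ) : Set (X × (ℕ → ℝ) × ℝ) :=
  {p | 0 ≤ p.2.2 ∧ (∀ k ≤ m, f k p.1 ≤ (p.2.1 k : EReal)) ∧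
    ∀ k, m < k → f k p.1 ≤ (p.2.2 : EReal)}

lemma convex_jointEpi {X : Type*} [AddCommGroup X] [Module ℝ X] {f : ℕ → X → EReal}
    (hconv : ∀ k, ConvexE (f k)) (m : ℕ) : Convex ℝ (jointEpi f m) := by
  rintro ⟨x, y, t⟩ ⟨ht, hy, hx⟩ ⟨x', y', t'⟩ ⟨ht', hy', hx'⟩ a b ha hb hab
  refine ⟨?_, fun k hk => ?_, fun k hk => ?_⟩
  · exact add_nonneg (mul_nonneg ha ht) (mul_nonneg hb ht')
  · exact @hconv k (x, y k) (hy k hk) (x', y' k) (hy' k hk) _ _ ha hb hab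
  · exact @hconv k (x, t) (hx k hk) (x', t') (hx' k hk) _ _ ha hb hab

lemma SlaterE.exists_pos {X : Type*} {f : ℕ → X → EReal} (h : SlaterE f) :
    ∃ (x : X) (s : ℝ), f 0 x ≠ ⊤ ∧ 0 < s ∧ ∀ k, 1 ≤ k → f k x ≤ ((-s : ℝ) : EReal) := by
  obtain ⟨x, hx, hsup⟩ := h
  obtain ⟨q, hq, hq0⟩ := EReal.lt_iff_exists_real_btwn.1 hsup
  refine ⟨x, -q, hx, ?_, fun k hk => ?_⟩
  · have : q < 0 := by exact_mod_cast hq0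
    linarith
  · rw [neg_neg]
    exact (le_iSup₂ (f := fun k (_ : 1 ≤ k) => f k x) k hk).trans hq.le

/-- Strong duality for `(D_m)`, as the existence of bounded multipliers. -/
lemma exists_forall_le_lagDm {X : Type*} [AddCommGroup X] [Module ℝ X] {f : ℕ → X → EReal}
    (hbot : ∀ k x, f k x ≠ ⊥) (hconv : ∀ k, ConvexE (f k)) (hslater : SlaterE f) {v : ℝ}
    (hv : ∀ x, feasE f x → (v : EReal) ≤ f 0 x) (m : ℕ) :
    ∃ lam : ℕ → ℝ, memLinfty lam ∧ ∀ x, (v : EReal) ≤ lagDm f m lam x := by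
  obtain ⟨x₀, s, hx₀, hs, hsx₀⟩ := hslater.exists_pos
  set r := (f 0 x₀).toReal
  have hr : f 0 x₀ = (r : EReal) := (EReal.coe_toReal hx₀ (hbot 0 x₀)).symm
  have hfeas₀ : feasE f x₀ := fun k hk =>
    (hsx₀ k hk).trans (by exact_mod_cast (neg_nonpos.2 hs.le))
  have hvr : v ≤ r := by
    have h := hv x₀ hfeas₀
    rw [hr] at h
    exact_mod_cast h
  set c := (r - v) / s + 1 with hc_def
  have hc : 0 < c := by
    have : 0 ≤ (r - v) / s := div_nonneg (by linarith) hs.le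
    linarith
  have hS := convex_jointEpi hconv m
  have hlin : ∀ k : ℕ, ConvexOn ℝ (jointEpi f m) (fun p => p.2.1 k) := fun k =>
    ⟨hS, fun _ _ _ _ _ _ _ _ _ => le_rfl⟩
  have hG : ConvexOn ℝ (jointEpi f m) (fun p => p.2.1 0 + c * p.2.2) :=
    (hlin 0).add (ConvexOn.smul hc.le ⟨hS, fun _ _ _ _ _ _ _ _ _ => le_rfl⟩)
  have hmem : ((x₀, fun k => if k = 0 then r else -s, 0) : X × (ℕ → ℝ) × ℝ) ∈ jointEpi f m := by
    refine ⟨le_rfl, fun k _ => ?_, fun k hk => hfeas₀ k (by omega)⟩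
    by_cases hk : k = 0
    · subst hk
      simp [hr]
    · simpa [hk] using hsx₀ k (by omega)
  obtain ⟨d, hd, hdv⟩ := exists_multipliers_of_convexOn hlin hmem (v := v) (Finset.Icc 1 m)
    (fun k hk => by
      have : k ≠ 0 := by have := (Finset.mem_Icc.1 hk).1; omega
      simp [this, hs]) hG
    (by
      rintro ⟨x, y, t⟩ ⟨ht, hy, hx⟩ hys
      have h := ConvexE.le_add_penalty hconv hv hs hr.le hsx₀ ht (hy 0 (Nat.zero_le m))
        (fun k hk => by
          by_cases hkm : k ≤ m
          · refine (hy k hkm).trans ?_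
            exact_mod_cast (hys k (Finset.mem_Icc.2 ⟨hk, hkm⟩)).trans ht
          · exact hx k (by omega))
      simp only [hc_def]
      simp only at ht
      linarith)
  have hlam : ∀ k, 0 ≤ (if k ≤ m then d k else c) := fun k => by
    split_ifs
    exacts [hd k, hc.le]
  refine ⟨fun k => if k ≤ m then d k else c, ⟨⟨c + ∑ k ∈ Finset.Iic m, d k, fun k => ?_⟩, hlam⟩,
    fun x => ?_⟩
  · rw [abs_of_nonneg (hlam k)]
    split_ifs with hk
    · linarith [Finset.single_le_sum (fun i _ => hd i) (Finset.mem_Iic.2 hk)]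
    · linarith [Finset.sum_nonneg (fun i (_ : i ∈ Finset.Iic m) => hd i)]
  · refine le_lagDm (fun k => hbot k x) hlam hc (fun k hk => if_neg (by omega))
      fun y t ht hy hx => ?_
    refine (hdv (x, y, t) ⟨ht, hy, hx⟩).trans_eq ?_
    congr 1
    exact Finset.sum_congr rfl fun k hk => by rw [if_pos (Finset.mem_Icc.1 hk).2]

/-- If x̄ solves (P) and the Slater condition holds, then for every m: (a) the dual (D_m)
has a solution λ with f_0(x̄) = inf_x L_m(x, λ); (b) for every solution of (D_m) the
infimum of the Lagrangian is attained at x̄ and the partial complementary slackness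
conditions λ_k f_k(x̄) = 0 (k = 1, …, m) hold. -/
theorem dualDm_solution_and_partial_complementary_slackness
    {X : Type*} [NormedAddCommGroup X] [NormedSpace ℝ X] [CompleteSpace X]
    (f : ℕ → X → EReal)
    (hproper : ∀ k, ProperE (f k)) (hconv : ∀ k, ConvexE (f k))
    (hC : ∃ x : X, f 0 x ≠ ⊤ ∧ feasE f x)
    (xb : X) (hfeas : feasE f xb) (hmin : ∀ x : X, feasE f x → f 0 xb ≤ f 0 x)
    (hslater : SlaterE f) :
    ∀ m : ℕ,
      (∃ lam : ℕ → ℝ, memLinfty lam ∧ f 0 xb = ⨅ x : X, lagDm f m lam x) ∧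
      (∀ lam : ℕ → ℝ, memLinfty lam →
        (⨅ x : X, lagDm f m lam x) = vDm f m →
        lagDm f m lam xb = (⨅ x : X, lagDm f m lam x) ∧
        (∀ k, 1 ≤ k → k ≤ m → smulE (lam k) (f k xb) = 0)) := by
  have hbot : ∀ k x, f k x ≠ ⊥ := fun k => (hproper k).1
  have htop : f 0 xb ≠ ⊤ := by
    obtain ⟨x, hx, hxf⟩ := hC
    exact ((hmin x hxf).trans_lt (lt_top_iff_ne_top.2 hx)).ne
  have hcoe := EReal.coe_toReal htop (hbot 0 xb)
  intro m
  have hweak : ∀ lam, memLinfty lam → lagDm f m lam xb ≤ f 0 xb := fun lam hlam =>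
    lagDm_le_of_feasE (fun k => hbot k xb) hlam.2 hfeas
  obtain ⟨lam₀, hlam₀, hle₀⟩ := exists_forall_le_lagDm hbot hconv hslater
    (v := (f 0 xb).toReal) (fun x hx => hcoe.trans_le (hmin x hx)) m
  rw [hcoe] at hle₀
  refine ⟨⟨lam₀, hlam₀, le_antisymm (le_iInf hle₀) ((iInf_le _ xb).trans (hweak _ hlam₀))⟩,
    fun lam hlam hsol => ?_⟩
  have hinf : f 0 xb ≤ ⨅ x : X, lagDm f m lam x := by
    rw [hsol]
    exact (le_iInf hle₀).trans
      (le_iSup₂ (f := fun lam (_ : memLinfty lam) => ⨅ x : X, lagDm f m lam x) lam₀ hlam₀)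
  refine ⟨le_antisymm ((hweak lam hlam).trans hinf) (iInf_le _ xb), fun k hk hkm => ?_⟩
  exact smulE_eq_zero_of_le_lagDm (fun k => hbot k xb) htop hlam.2 hfeas
    (hinf.trans (iInf_le _ xb)) hk hkm

end
end

section
/- Consider in ℝ² the functions f_0(u_1,u_2) := u_2, f_1(u_1,u_2) := −u_2 − 1, f_2(u_1,u_2) := u_1, and f_k(u_1,u_2) := u_1/k − u_2 for k = 3, 4, …. Then: (a) the infimum of f_0 over the set {x ∈ ℝ² : f_k(x) ≤ 0 for all k ∈ ℕ} equals 0, and the set of minimizers is (−∞,0] × {0}; (b) for every finitely supported λ = (λ_1, λ_2, …) with λ_k ≥ 0, the quantity inf_{x∈ℝ²} ( f_0(x) + ∑_{k∈ℕ} λ_k f_k(x) ) equals −1 if λ_1 = 1 and λ_k = 0 for all k ≥ 2, and equals −∞ otherwise; consequently the Haar dual value sup over finitely supported λ ≥ 0 of inf_{x∈ℝ²} ( f_0(x) + ∑_{k∈ℕ} λ_k f_k(x) ) equals −1, so there is a nonzero duality gap even though the Slater condition holds. -/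
open scoped BigOperators

noncomputable section

/-- The constraint functions of Karney's example: f_1(u) = −u_2 − 1, f_2(u) = u_1,
f_k(u) = u_1/k − u_2 (k ≥ 3). (The value at k = 0 is irrelevant.) -/
def karneyF : ℕ → ℝ × ℝ → ℝ :=
  fun k p => if k = 1 then -p.2 - 1 else if k = 2 then p.1 else p.1 / k - p.2

theorem karneyF_of_three_le {k : ℕ} (hk : 3 ≤ k) (p : ℝ × ℝ) :
    karneyF k p = p.1 / k - p.2 := by
  rw [karneyF, if_neg (by omega), if_neg (by omega)]

/-- The feasible set of Karney's example. -/
theorem karneyF_feasible_iff (p : ℝ × ℝ) :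
    (∀ k, 1 ≤ k → karneyF k p ≤ 0) ↔ p.1 ≤ 0 ∧ 0 ≤ p.2 := by
  constructor
  · intro h
    refine ⟨by simpa [karneyF] using h 2 (by norm_num), ?_⟩
    refine le_of_tendsto' (f := fun n : ℕ => p.1 / ((n + 3 : ℕ) : ℝ)) (x := Filter.atTop) ?_ ?_
    · exact (Filter.tendsto_add_atTop_iff_nat 3).2 (tendsto_const_div_atTop_nhds_zero_nat p.1)
    · intro n
      have := h (n + 3) (by omega)
      rw [karneyF_of_three_le (by omega)] at this
      linarith
  · rintro ⟨h1, h2⟩ k hk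
    have : p.1 / (k : ℝ) ≤ 0 := div_nonpos_of_nonpos_of_nonneg h1 (Nat.cast_nonneg k)
    unfold karneyF
    split_ifs <;> linarith

/-- The coefficient of the first variable in `karneyF k`. -/
def karneyCoeffFst (k : ℕ) : ℝ := if k = 1 then 0 else if k = 2 then 1 else 1 / k

/-- The coefficient of the second variable in `karneyF k`. -/
def karneyCoeffSnd (k : ℕ) : ℝ := if k = 1 then -1 else if k = 2 then 0 else -1

/-- The constant term of `karneyF k`. -/
def karneyConst (k : ℕ) : ℝ := if k = 1 then -1 else 0

theorem karneyF_eq_affine (k : ℕ) (p : ℝ × ℝ) :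
    karneyF k p = karneyCoeffFst k * p.1 + karneyCoeffSnd k * p.2 + karneyConst k := by
  unfold karneyF karneyCoeffFst karneyCoeffSnd karneyConst
  split_ifs <;> ring

theorem karneyCoeffFst_nonneg (k : ℕ) : 0 ≤ karneyCoeffFst k := by
  unfold karneyCoeffFst
  split_ifs <;> positivity

theorem karneyCoeffFst_pos {k : ℕ} (hk : 2 ≤ k) : 0 < karneyCoeffFst k := by
  unfold karneyCoeffFst
  have : (0 : ℝ) < k := by exact_mod_cast (by omega : 0 < k)
  split_ifs
  · omega
  · positivity
  · positivity

/-- A nonconstant affine function on the plane is unbounded below. -/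
theorem iInf_affine_eq_bot {a b : ℝ} (c : ℝ) (h : ¬(a = 0 ∧ b = 0)) :
    (⨅ p : ℝ × ℝ, ((a * p.1 + b * p.2 + c : ℝ) : EReal)) = ⊥ := by
  have hab : a * a + b * b ≠ 0 := fun h0 => h (mul_self_add_mul_self_eq_zero.1 h0)
  refine (EReal.eq_bot_iff_forall_lt _).2 fun y => ?_
  set t := (y - 1 - c) / (a * a + b * b)
  refine (iInf_le _ (t * a, t * b)).trans_lt ?_
  have hval : a * (t * a) + b * (t * b) + c = y - 1 := by
    have : t * (a * a + b * b) = y - 1 - c := div_mul_cancel₀ _ hab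
    linarith
  simp only [hval]
  exact_mod_cast sub_one_lt y

/-- The Haar Lagrangian of Karney's example at a finitely supported multiplier is affine. -/
theorem karney_lagrangian_eq_affine {lam : ℕ → ℝ} (hfin : {k | lam k ≠ 0}.Finite) (p : ℝ × ℝ) :
    p.2 + ∑ᶠ k, lam k * karneyF k p =
      (∑ k ∈ hfin.toFinset, lam k * karneyCoeffFst k) * p.1 +
        (1 + ∑ k ∈ hfin.toFinset, lam k * karneyCoeffSnd k) * p.2 +
        ∑ k ∈ hfin.toFinset, lam k * karneyConst k := by
  rw [finsum_eq_sum_of_support_subset (s := hfin.toFinset)]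
  · rw [add_mul, one_mul, Finset.sum_mul, Finset.sum_mul, ← add_assoc, add_comm _ p.2, add_assoc,
      add_assoc, ← Finset.sum_add_distrib, ← Finset.sum_add_distrib]
    congr 1
    refine Finset.sum_congr rfl fun k _ => ?_
    rw [karneyF_eq_affine]
    ring
  · intro k hk
    simpa using left_ne_zero_of_mul hk

theorem karney_multiplier_eq {lam : ℕ → ℝ} (hnn : ∀ k, 0 ≤ lam k) (h0 : lam 0 = 0)
    (hfin : {k | lam k ≠ 0}.Finite)
    (ha : ∑ k ∈ hfin.toFinset, lam k * karneyCoeffFst k = 0)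
    (hb : 1 + ∑ k ∈ hfin.toFinset, lam k * karneyCoeffSnd k = 0) :
    lam 1 = 1 ∧ ∀ k, 2 ≤ k → lam k = 0 := by
  have hzero : ∀ k, 2 ≤ k → lam k = 0 := by
    intro k hk
    by_contra hne
    have hterm := (Finset.sum_eq_zero_iff_of_nonneg
      fun i _ => mul_nonneg (hnn i) (karneyCoeffFst_nonneg i)).1 ha k (by simpa using hne)
    exact mul_ne_zero hne (karneyCoeffFst_pos hk).ne' hterm
  refine ⟨?_, hzero⟩
  rw [Finset.sum_eq_single 1] at hb
  · simp only [karneyCoeffSnd, if_true] at hb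
    linarith
  · intro k _ hk
    rcases Nat.lt_or_ge k 2 with hlt | hge
    · obtain rfl : k = 0 := by omega
      rw [h0, zero_mul]
    · rw [hzero k hge, zero_mul]
  · intro hk
    have : lam 1 = 0 := by simpa using hk
    rw [this, zero_mul]

theorem karney_dual_value_of_eq {lam : ℕ → ℝ} (h0 : lam 0 = 0) (h1 : lam 1 = 1)
    (h2 : ∀ k, 2 ≤ k → lam k = 0) :
    (⨅ p : ℝ × ℝ, ((p.2 + ∑ᶠ k, lam k * karneyF k p : ℝ) : EReal)) = (-1 : EReal) := by
  have hval : ∀ p : ℝ × ℝ, p.2 + ∑ᶠ k, lam k * karneyF k p = -1 := by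
    intro p
    rw [finsum_eq_single _ 1]
    · rw [h1, karneyF, if_pos rfl]
      ring
    · intro k hk
      rcases Nat.lt_or_ge k 2 with hlt | hge
      · obtain rfl : k = 0 := by omega
        rw [h0, zero_mul]
      · rw [h2 k hge, zero_mul]
  simp only [hval, iInf_const]
  simp

theorem karney_dual_value_of_ne {lam : ℕ → ℝ} (hnn : ∀ k, 0 ≤ lam k) (h0 : lam 0 = 0)
    (hfin : {k | lam k ≠ 0}.Finite) (hne : ¬(lam 1 = 1 ∧ ∀ k, 2 ≤ k → lam k = 0)) :
    (⨅ p : ℝ × ℝ, ((p.2 + ∑ᶠ k, lam k * karneyF k p : ℝ) : EReal)) = ⊥ := by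
  simp only [karney_lagrangian_eq_affine hfin]
  exact iInf_affine_eq_bot _ fun h => hne (karney_multiplier_eq hnn h0 hfin h.1 h.2)

/-- Karney's example: the primal optimal value is 0 with solution set (−∞,0] × {0},
while the Haar dual has optimal value −1, so there is a nonzero duality gap even
though the Slater condition holds. -/
theorem karney_example_haar_duality_gap :
    -- (a) the optimal value of (P) is 0 …
    (⨅ (p : ℝ × ℝ) (_ : ∀ k, 1 ≤ k → karneyF k p ≤ 0), ((p.2 : ℝ) : EReal)) = 0 ∧
    -- … and the set of minimizers is (−∞,0] × {0}
    {p : ℝ × ℝ | (∀ k, 1 ≤ k → karneyF k p ≤ 0) ∧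
        ∀ q : ℝ × ℝ, (∀ k, 1 ≤ k → karneyF k q ≤ 0) → p.2 ≤ q.2}
      = Set.Iic (0 : ℝ) ×ˢ {(0 : ℝ)} ∧
    -- (b) value of the inner infimum of the Haar Lagrangian, for each admissible λ
    (∀ lam : ℕ → ℝ, (∀ k, 0 ≤ lam k) → lam 0 = 0 → {k | lam k ≠ 0}.Finite →
      ((lam 1 = 1 ∧ ∀ k, 2 ≤ k → lam k = 0) →
        (⨅ p : ℝ × ℝ, ((p.2 + ∑ᶠ k, lam k * karneyF k p : ℝ) : EReal)) = (-1 : EReal)) ∧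
      (¬(lam 1 = 1 ∧ ∀ k, 2 ≤ k → lam k = 0) →
        (⨅ p : ℝ × ℝ, ((p.2 + ∑ᶠ k, lam k * karneyF k p : ℝ) : EReal)) = ⊥)) ∧
    -- consequently the Haar dual value is −1 …
    (⨆ (lam : ℕ → ℝ)
        (_ : (∀ k, 0 ≤ lam k) ∧ lam 0 = 0 ∧ {k | lam k ≠ 0}.Finite),
      ⨅ p : ℝ × ℝ, ((p.2 + ∑ᶠ k, lam k * karneyF k p : ℝ) : EReal)) = (-1 : EReal) ∧
    -- … even though the Slater condition holds
    (∃ p : ℝ × ℝ, (⨆ (k : ℕ) (_ : 1 ≤ k), ((karneyF k p : ℝ) : EReal)) < 0) := by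
  refine ⟨?_, ?_, ?_, ?_, ?_⟩
  · simp only [karneyF_feasible_iff]
    refine le_antisymm ?_ (le_iInf₂ fun p hp => by exact_mod_cast hp.2)
    exact (iInf₂_le ((0 : ℝ), (0 : ℝ)) ⟨le_rfl, le_rfl⟩).trans (by simp)
  · ext p
    simp only [karneyF_feasible_iff, Set.mem_ofPred_eq, Set.mem_prod, Set.mem_Iic,
      Set.mem_singleton_iff]
    constructor
    · rintro ⟨⟨h1, h2⟩, hmin⟩
      exact ⟨h1, le_antisymm (hmin (0, 0) ⟨le_rfl, le_rfl⟩) h2⟩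
    · rintro ⟨h1, h2⟩
      exact ⟨⟨h1, h2.ge⟩, fun q hq => h2.le.trans hq.2⟩
  · exact fun lam hnn h0 hfin => ⟨fun h => karney_dual_value_of_eq h0 h.1 h.2,
      karney_dual_value_of_ne hnn h0 hfin⟩
  · refine le_antisymm (iSup₂_le fun lam hlam => ?_) ?_
    · by_cases h : lam 1 = 1 ∧ ∀ k, 2 ≤ k → lam k = 0
      · exact (karney_dual_value_of_eq hlam.2.1 h.1 h.2).le
      · rw [karney_dual_value_of_ne hlam.1 hlam.2.1 hlam.2.2 h]
        exact bot_le
    · have hsingle : ∀ k, 2 ≤ k → (Pi.single 1 1 : ℕ → ℝ) k = 0 := fun k hk =>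
        Pi.single_eq_of_ne (by omega) _
      refine (karney_dual_value_of_eq (lam := Pi.single 1 1) (by simp) (by simp) hsingle).ge.trans
        (le_iSup₂_of_le (Pi.single 1 1) ⟨?_, by simp, ?_⟩ le_rfl)
      · exact (Pi.single_nonneg.2 zero_le_one : (0 : ℕ → ℝ) ≤ Pi.single 1 1)
      · refine (Set.finite_singleton 1).subset fun k hk => ?_
        by_contra hne
        exact hk (Pi.single_eq_of_ne hne _)
  · refine ⟨(-1, 1), lt_of_le_of_lt (b := ((-1 : ℝ) : EReal)) (iSup₂_le fun k _ => ?_) ?_⟩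
    · rw [EReal.coe_le_coe_iff]
      have : (-1 : ℝ) / k ≤ 0 := div_nonpos_of_nonpos_of_nonneg (by norm_num) (Nat.cast_nonneg k)
      unfold karneyF
      split_ifs <;> linarith
    · exact_mod_cast neg_one_lt_zero (R := ℝ)

end
end
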